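/- Suppose ℓ : ℝ → ℝ has one of the following four forms: ℓ₁(x) = (x−m)₊ for some m ∈ ℝ; ℓ₂(x) = (m−x)₊ for some m ∈ ℝ; ℓ₃(x) = (|x−m₁|−m₂)₊ for some m₁ ∈ ℝ and m₂ ≥ 0; ℓ₄(x) = |x−m| + b for some m ∈ ℝ and b > 0. Then for every p ∈ (1,∞), every Borel probability distribution F₀ on ℝⁿ with finite p-th moment, every ε ≥ 0, and every D ⊆ ℝⁿ: inf_{β∈D} sup_{F∈B_p(F₀,ε)} E^F[ℓ(β^⊤Z)^p] = inf_{β∈D} ( (E^{F₀}[ℓ(β^⊤Z)^p])^{1/p} + ε‖β‖_* )^p. -/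

import Mathlib

open MeasureTheory Set
open scoped ENNReal NNReal

noncomputable section

abbrev Vec (n : ℕ) := Fin n → ℝ

/-- `β^⊤x` -/
def dotp {n : ℕ} (β x : Vec n) : ℝ := ∑ i, β i * x i

/-- `nrm` is a norm on `ℝⁿ`. -/
def IsNorm {n : ℕ} (nrm : Vec n → ℝ) : Prop :=
  (∀ x, nrm x = 0 ↔ x = 0) ∧
  (∀ (c : ℝ) (x : Vec n), nrm (c • x) = |c| * nrm x) ∧
  (∀ x y : Vec n, nrm (x + y) ≤ nrm x + nrm y)

/-- the dual norm `‖β‖_* = sup_{‖x‖ ≤ 1} β^⊤x`. -/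
def dualNorm {n : ℕ} (nrm : Vec n → ℝ) (β : Vec n) : ℝ :=
  sSup {r | ∃ x, nrm x ≤ 1 ∧ r = dotp β x}

/-- Couplings of two probability measures. -/
def Couplings {E : Type*} [MeasurableSpace E] (μ ν : Measure E) : Set (Measure (E × E)) :=
  {π | IsProbabilityMeasure π ∧ π.map Prod.fst = μ ∧ π.map Prod.snd = ν}

/-- The type-`p` Wasserstein distance (valued in `ℝ≥0∞`) associated with an
extended-real-valued cost; for `p = ∞` it is the infimum over couplings of the essential
supremum of the cost. -/
def WassersteinD {E : Type*} [MeasurableSpace E] (cost : E → E → ℝ≥0∞) (p : ℝ≥0∞)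
    (μ ν : Measure E) : ℝ≥0∞ :=
  if p = ∞ then ⨅ π ∈ Couplings μ ν, essSup (fun z : E × E => cost z.1 z.2) π
  else ⨅ π ∈ Couplings μ ν, (∫⁻ z, cost z.1 z.2 ^ p.toReal ∂π) ^ (1 / p.toReal)

/-- Finite `p`-th moment (with respect to a "norm-like" function `nrm`);
for `p = ∞` it means essential boundedness. -/
def HasMomentP {E : Type*} [MeasurableSpace E] (nrm : E → ℝ) (p : ℝ≥0∞) (μ : Measure E) : Prop :=
  if p = ∞ then essSup (fun x => ENNReal.ofReal (nrm x)) μ ≠ ∞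
  else ∫⁻ x, ENNReal.ofReal (nrm x) ^ p.toReal ∂μ ≠ ∞

/-- The type-`p` Wasserstein ball of probability distributions on `ℝⁿ` (norm `nrm`). -/
def WballVec {n : ℕ} (nrm : Vec n → ℝ) (p : ℝ≥0∞) (μ₀ : Measure (Vec n)) (ε : ℝ) :
    Set (Measure (Vec n)) :=
  {μ | IsProbabilityMeasure μ ∧ HasMomentP nrm p μ ∧
    WassersteinD (fun x y => ENNReal.ofReal (nrm (x - y))) p μ μ₀ ≤ ENNReal.ofReal ε}

/-- The type-`p` Wasserstein ball of probability distributions on `ℝ`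
(absolute-value norm). -/
def WballReal (p : ℝ≥0∞) (μ₀ : Measure ℝ) (ε : ℝ) : Set (Measure ℝ) :=
  {μ | IsProbabilityMeasure μ ∧ HasMomentP (fun x : ℝ => |x|) p μ ∧
    WassersteinD (fun x y : ℝ => ENNReal.ofReal |x - y|) p μ μ₀ ≤ ENNReal.ofReal ε}

/-- The metric on `Ξ = {-1,1} × ℝⁿ`:
`d((y₁,x₁),(y₂,x₂)) = ‖x₁ - x₂‖` if `y₁ = y₂`, and `+∞` otherwise. -/
def xiCost {n : ℕ} (nrm : Vec n → ℝ) (z₁ z₂ : ℝ × Vec n) : ℝ≥0∞ :=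
  if z₁.1 = z₂.1 then ENNReal.ofReal (nrm (z₁.2 - z₂.2)) else ∞

/-- A measure on `ℝ × ℝⁿ` is concentrated on `Ξ = {-1,1} × ℝⁿ`. -/
def OnXi {n : ℕ} (μ : Measure (ℝ × Vec n)) : Prop :=
  μ {z | z.1 = 1 ∨ z.1 = -1} = 1

/-- The type-`p` Wasserstein ball `B̄_p(F₀,ε)` of probability distributions on
`Ξ = {-1,1} × ℝⁿ`. -/
def WballXi {n : ℕ} (nrm : Vec n → ℝ) (p : ℝ≥0∞) (μ₀ : Measure (ℝ × Vec n)) (ε : ℝ) :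
    Set (Measure (ℝ × Vec n)) :=
  {μ | IsProbabilityMeasure μ ∧ OnXi μ ∧ HasMomentP (fun z => nrm z.2) p μ ∧
    WassersteinD (xiCost nrm) p μ μ₀ ≤ ENNReal.ofReal ε}

/-- The four loss functions of Theorem 6 of the paper:
`ℓ₁(x) = (x-m)₊`, `ℓ₂(x) = (m-x)₊`, `ℓ₃(x) = (|x-m₁|-m₂)₊`, `ℓ₄(x) = |x-m| + b` (`b > 0`). -/
def IsCanonicalLoss (ℓ : ℝ → ℝ) : Prop :=
  (∃ m : ℝ, ℓ = fun x => max (x - m) 0) ∨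
  (∃ m : ℝ, ℓ = fun x => max (m - x) 0) ∨
  (∃ m₁ m₂ : ℝ, 0 ≤ m₂ ∧ ℓ = fun x => max (|x - m₁| - m₂) 0) ∨
  (∃ m b : ℝ, 0 < b ∧ ℓ = fun x => |x - m| + b)

namespace IsNorm

variable {n : ℕ} {nrm : Vec n → ℝ}

lemma map_zero (h : IsNorm nrm) : nrm 0 = 0 := (h.1 0).2 rfl

lemma nonneg (h : IsNorm nrm) (x : Vec n) : 0 ≤ nrm x := by
  have h1 := h.2.2 x ((-1 : ℝ) • x)
  rw [h.2.1] at h1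
  simp [h.map_zero] at h1
  linarith

lemma continuous (h : IsNorm nrm) : Continuous nrm := by
  have hc : ConvexOn ℝ univ nrm := by
    refine ⟨convex_univ, fun x _ y _ a b ha hb _ => (h.2.2 _ _).trans_eq ?_⟩
    rw [h.2.1, h.2.1, abs_of_nonneg ha, abs_of_nonneg hb, smul_eq_mul, smul_eq_mul]
  exact continuousOn_univ.1 (hc.continuousOn isOpen_univ)

lemma exists_norm_le (h : IsNorm nrm) : ∃ C, 0 < C ∧ ∀ x, ‖x‖ ≤ C * nrm x := by
  rcases (Metric.sphere (0 : Vec n) 1).eq_empty_or_nonempty with he | hne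
  · refine ⟨1, one_pos, fun x => ?_⟩
    by_cases hx : x = 0
    · simp [hx, h.map_zero]
    · have : ‖x‖⁻¹ • x ∈ Metric.sphere (0 : Vec n) 1 := by
        simp [norm_smul, hx]
      simp [he] at this
  · obtain ⟨y, hy, hmin⟩ :=
      (isCompact_sphere (0 : Vec n) 1).exists_isMinOn hne h.continuous.continuousOn
    have hy0 : 0 < nrm y := by
      refine lt_of_le_of_ne (h.nonneg y) fun h0 => ?_
      simp [(h.1 y).1 h0.symm] at hy
    refine ⟨(nrm y)⁻¹, inv_pos.2 hy0, fun x => ?_⟩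
    by_cases hx : x = 0
    · simp [hx, h.map_zero]
    have hxs : ‖x‖⁻¹ • x ∈ Metric.sphere (0 : Vec n) 1 := by
      simp [norm_smul, hx]
    have hle : nrm y ≤ nrm (‖x‖⁻¹ • x) := hmin hxs
    have hxp : 0 < ‖x‖ := norm_pos_iff.2 hx
    rw [h.2.1, abs_of_pos (inv_pos.2 hxp), inv_mul_eq_div, le_div_iff₀ hxp] at hle
    rw [inv_mul_eq_div, le_div_iff₀ hy0]
    linarith

lemma isCompact_unitBall (h : IsNorm nrm) : IsCompact {x | nrm x ≤ 1} := by
  obtain ⟨C, hC, hle⟩ := h.exists_norm_le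
  refine (isCompact_closedBall (0 : Vec n) C).of_isClosed_subset
    (isClosed_le h.continuous continuous_const) fun x hx => ?_
  have hx' : nrm x ≤ 1 := hx
  rw [mem_closedBall_zero_iff]
  exact (hle x).trans (by nlinarith)

end IsNorm

section dotp

variable {n : ℕ} {nrm : Vec n → ℝ}

lemma dotp_add (β x y : Vec n) : dotp β (x + y) = dotp β x + dotp β y := by
  simp [dotp, mul_add, Finset.sum_add_distrib]

lemma dotp_smul (β : Vec n) (c : ℝ) (x : Vec n) : dotp β (c • x) = c * dotp β x := by
  simp only [dotp, Finset.mul_sum, Pi.smul_apply, smul_eq_mul]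
  exact Finset.sum_congr rfl fun i _ => by ring

lemma dotp_sub (β x y : Vec n) : dotp β (x - y) = dotp β x - dotp β y := by
  simp [dotp, mul_sub, Finset.sum_sub_distrib]

lemma continuous_dotp (β : Vec n) : Continuous (dotp β) := by
  unfold dotp
  fun_prop

lemma exists_dotp_eq_dualNorm (h : IsNorm nrm) (β : Vec n) :
    ∃ v, nrm v ≤ 1 ∧ dotp β v = dualNorm nrm β ∧
      ∀ x, nrm x ≤ 1 → dotp β x ≤ dualNorm nrm β := by
  obtain ⟨v, hv, hmax⟩ := h.isCompact_unitBall.exists_isMaxOn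
    ⟨0, by simp [h.map_zero]⟩ (continuous_dotp β).continuousOn
  have hg : IsGreatest {r | ∃ x, nrm x ≤ 1 ∧ r = dotp β x} (dotp β v) :=
    ⟨⟨v, hv, rfl⟩, by rintro _ ⟨x, hx, rfl⟩; exact hmax hx⟩
  refine ⟨v, hv, hg.csSup_eq.symm, fun x hx => ?_⟩
  rw [dualNorm, hg.csSup_eq]
  exact hmax hx

lemma dualNorm_nonneg (h : IsNorm nrm) (β : Vec n) : 0 ≤ dualNorm nrm β := by
  obtain ⟨-, -, -, hle⟩ := exists_dotp_eq_dualNorm h β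
  simpa [dotp] using hle 0 (by simp [h.map_zero])

lemma dotp_le_dualNorm_mul (h : IsNorm nrm) (β x : Vec n) :
    dotp β x ≤ dualNorm nrm β * nrm x := by
  obtain ⟨-, -, -, hle⟩ := exists_dotp_eq_dualNorm h β
  rcases (h.nonneg x).eq_or_lt with h0 | hpos
  · rw [(h.1 x).1 h0.symm]
    simp [dotp, h.map_zero]
  · have h1 := hle ((nrm x)⁻¹ • x) (by
      rw [h.2.1, abs_of_pos (inv_pos.2 hpos), inv_mul_cancel₀ hpos.ne'])
    rw [dotp_smul, inv_mul_eq_div, div_le_iff₀ hpos] at h1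
    exact h1

lemma abs_dotp_le (h : IsNorm nrm) (β x : Vec n) :
    |dotp β x| ≤ dualNorm nrm β * nrm x := by
  refine abs_le'.2 ⟨dotp_le_dualNorm_mul h β x, ?_⟩
  have h1 := dotp_le_dualNorm_mul h β ((-1 : ℝ) • x)
  rw [dotp_smul, h.2.1] at h1
  simpa using h1

end dotp

section eLpNorm

variable {Ω : Type*} [MeasurableSpace Ω] {μ : Measure Ω} {p : ℝ}

lemma lintegral_ofReal_rpow_rpow_inv {f : Ω → ℝ} (hp : 0 < p) (hf : ∀ x, 0 ≤ f x) :
    (∫⁻ x, ENNReal.ofReal (f x) ^ p ∂μ) ^ (1 / p) = eLpNorm f (ENNReal.ofReal p) μ := by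
  rw [eLpNorm_eq_lintegral_rpow_enorm_toReal (by simpa using hp) ENNReal.ofReal_ne_top,
    ENNReal.toReal_ofReal hp.le]
  simp_rw [Real.enorm_of_nonneg (hf _)]

lemma integral_rpow_eq_eLpNorm {f : Ω → ℝ} (hp : 0 < p) (hf : ∀ x, 0 ≤ f x)
    (hm : Measurable f) :
    ∫ x, f x ^ p ∂μ = (eLpNorm f (ENNReal.ofReal p) μ).toReal ^ p := by
  rw [← lintegral_ofReal_rpow_rpow_inv hp hf, ENNReal.toReal_rpow, ← ENNReal.rpow_mul,
    one_div_mul_cancel hp.ne', ENNReal.rpow_one,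
    integral_eq_lintegral_of_nonneg_ae (.of_forall fun x => Real.rpow_nonneg (hf x) p)
      (hm.pow_const p).aestronglyMeasurable]
  simp_rw [ENNReal.ofReal_rpow_of_nonneg (hf _) hp.le]

lemma hasMomentP_iff {f : Ω → ℝ} (hp : 0 < p) (hf : ∀ x, 0 ≤ f x) (hm : Measurable f) :
    HasMomentP f (ENNReal.ofReal p) μ ↔ MemLp f (ENNReal.ofReal p) μ := by
  rw [HasMomentP, if_neg ENNReal.ofReal_ne_top, ENNReal.toReal_ofReal hp.le, MemLp,
    and_iff_right hm.aestronglyMeasurable, ← lintegral_ofReal_rpow_rpow_inv hp hf, lt_top_iff_ne_top,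
    not_iff_not, ENNReal.rpow_eq_top_iff_of_pos (one_div_pos.2 hp)]

end eLpNorm

section Wasserstein

variable {n : ℕ} {nrm : Vec n → ℝ} {p ε : ℝ} {F₀ : Measure (Vec n)}

lemma wassersteinD_eq (h : IsNorm nrm) (hp : 0 < p) (μ ν : Measure (Vec n)) :
    WassersteinD (fun x y => ENNReal.ofReal (nrm (x - y))) (ENNReal.ofReal p) μ ν =
      ⨅ π ∈ Couplings μ ν, eLpNorm (fun z => nrm (z.1 - z.2)) (ENNReal.ofReal p) π := by
  rw [WassersteinD, if_neg ENNReal.ofReal_ne_top, ENNReal.toReal_ofReal hp.le]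
  simp_rw [← lintegral_ofReal_rpow_rpow_inv hp fun z : Vec n × Vec n => h.nonneg (z.1 - z.2)]

lemma map_mem_wballVec {Ω : Type*} [MeasurableSpace Ω] {P : Measure Ω} [IsProbabilityMeasure P]
    (h : IsNorm nrm) (hp : 1 ≤ p) {X Y : Ω → Vec n} (hX : Measurable X) (hY : Measurable Y)
    (hYF : P.map Y = F₀) (hmom : HasMomentP nrm (ENNReal.ofReal p) F₀)
    (hXY : eLpNorm (fun ω => nrm (X ω - Y ω)) (ENNReal.ofReal p) P ≤ ENNReal.ofReal ε) :
    P.map X ∈ WballVec nrm (ENNReal.ofReal p) F₀ ε := by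
  have hp0 : 0 < p := one_pos.trans_le hp
  have hN := h.continuous.measurable
  refine ⟨Measure.isProbabilityMeasure_map hX.aemeasurable, ?_, ?_⟩
  · rw [hasMomentP_iff hp0 h.nonneg hN] at hmom ⊢
    rw [← hYF, memLp_map_measure_iff hN.aestronglyMeasurable hY.aemeasurable] at hmom
    rw [memLp_map_measure_iff hN.aestronglyMeasurable hX.aemeasurable]
    have hd : MemLp (fun ω => nrm (X ω - Y ω)) (ENNReal.ofReal p) P :=
      ⟨(hN.comp (hX.sub hY)).aestronglyMeasurable, hXY.trans_lt ENNReal.ofReal_lt_top⟩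
    refine (hd.add hmom).mono (hN.comp hX).aestronglyMeasurable (.of_forall fun ω => ?_)
    simp only [Function.comp, Pi.add_apply, Real.norm_eq_abs]
    rw [abs_of_nonneg (h.nonneg _), abs_of_nonneg (add_nonneg (h.nonneg _) (h.nonneg _))]
    simpa using h.2.2 (X ω - Y ω) (Y ω)
  · rw [wassersteinD_eq h hp0]
    have hXYm : Measurable fun ω => (X ω, Y ω) := hX.prodMk hY
    have hC : P.map (fun ω => (X ω, Y ω)) ∈ Couplings (P.map X) F₀ := by
      refine ⟨Measure.isProbabilityMeasure_map hXYm.aemeasurable, ?_, ?_⟩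
      · rw [Measure.map_map measurable_fst hXYm]; rfl
      · rw [Measure.map_map measurable_snd hXYm]; exact hYF
    refine (iInf₂_le _ hC).trans ?_
    have hd : Measurable fun z : Vec n × Vec n => nrm (z.1 - z.2) :=
      hN.comp (measurable_fst.sub measurable_snd)
    rw [eLpNorm_map_measure hd.aestronglyMeasurable hXYm.aemeasurable]
    exact hXY

/-- A `1`-Lipschitz loss of `β^⊤Z` changes by at most `ε‖β‖_*` in `L^p` over the ball. -/
lemma eLpNorm_loss_le (h : IsNorm nrm) (hp : 1 ≤ p) (hε : 0 ≤ ε) {ℓ : ℝ → ℝ}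
    (hℓ0 : ∀ x, 0 ≤ ℓ x) (hℓ : LipschitzWith 1 ℓ) (β : Vec n) {F : Measure (Vec n)}
    (hF : F ∈ WballVec nrm (ENNReal.ofReal p) F₀ ε) :
    eLpNorm (fun x => ℓ (dotp β x)) (ENNReal.ofReal p) F ≤
      eLpNorm (fun x => ℓ (dotp β x)) (ENNReal.ofReal p) F₀ +
        ENNReal.ofReal (ε * dualNorm nrm β) := by
  obtain ⟨-, -, hW⟩ := hF
  have hp0 : 0 < p := one_pos.trans_le hp
  have hB := dualNorm_nonneg h β
  have hL : Measurable fun x => ℓ (dotp β x) :=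
    (hℓ.continuous.comp (continuous_dotp β)).measurable
  have key : ∀ δ : ℝ, 0 < δ → eLpNorm (fun x => ℓ (dotp β x)) (ENNReal.ofReal p) F ≤
      eLpNorm (fun x => ℓ (dotp β x)) (ENNReal.ofReal p) F₀ +
        ENNReal.ofReal ((ε + δ) * dualNorm nrm β) := by
    intro δ hδ
    have hlt := hW.trans_lt ((ENNReal.ofReal_lt_ofReal_iff (by linarith)).2
      (show ε < ε + δ by linarith))
    rw [wassersteinD_eq h hp0] at hlt
    simp only [iInf_lt_iff] at hlt
    obtain ⟨π, ⟨-, h1, h2⟩, hπ⟩ := hlt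
    rw [← h1, ← h2, eLpNorm_map_measure hL.aestronglyMeasurable measurable_fst.aemeasurable,
      eLpNorm_map_measure hL.aestronglyMeasurable measurable_snd.aemeasurable]
    have hd : Measurable fun z : Vec n × Vec n => nrm (z.1 - z.2) :=
      h.continuous.measurable.comp (measurable_fst.sub measurable_snd)
    have h3 : AEStronglyMeasurable (fun z : Vec n × Vec n => ℓ (dotp β z.2)) π :=
      (hL.comp measurable_snd).aestronglyMeasurable
    have h4 := eLpNorm_add_le h3 (hd.const_smul (dualNorm nrm β)).aestronglyMeasurable
      (show 1 ≤ ENNReal.ofReal p by simpa using hp)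
    refine (eLpNorm_mono_real fun z => ?_).trans (h4.trans ?_)
    · have h3 := hℓ.dist_le_mul (dotp β z.1) (dotp β z.2)
      have h4 := abs_dotp_le h β (z.1 - z.2)
      rw [dotp_sub] at h4
      simp only [Real.dist_eq, NNReal.coe_one, one_mul] at h3
      simp only [Function.comp, Pi.add_apply, Pi.smul_apply, smul_eq_mul, Real.norm_eq_abs,
        abs_of_nonneg (hℓ0 _)]
      linarith [le_abs_self (ℓ (dotp β z.1) - ℓ (dotp β z.2))]
    · rw [eLpNorm_const_smul, mul_comm (ε + δ), ENNReal.ofReal_mul hB, Real.enorm_of_nonneg hB]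
      exact add_le_add le_rfl (mul_le_mul_right hπ.le _)
  have hlim : Filter.Tendsto (fun δ : ℝ => eLpNorm (fun x => ℓ (dotp β x)) (ENNReal.ofReal p) F₀ +
      ENNReal.ofReal ((ε + δ) * dualNorm nrm β)) (nhdsWithin 0 (Ioi 0))
      (nhds (eLpNorm (fun x => ℓ (dotp β x)) (ENNReal.ofReal p) F₀ +
        ENNReal.ofReal (ε * dualNorm nrm β))) := by
    have hc : Filter.Tendsto (fun δ : ℝ => ENNReal.ofReal ((ε + δ) * dualNorm nrm β))
        (nhds 0) (nhds (ENNReal.ofReal ((ε + 0) * dualNorm nrm β))) :=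
      ENNReal.tendsto_ofReal (Continuous.tendsto (by fun_prop) 0)
    rw [add_zero] at hc
    exact (tendsto_const_nhds.add hc).mono_left nhdsWithin_le_nhds
  exact ge_of_tendsto hlim (eventually_nhdsWithin_of_forall key)

end Wasserstein

section Loss

namespace IsCanonicalLoss

variable {ℓ : ℝ → ℝ}

lemma nonneg (h : IsCanonicalLoss ℓ) (x : ℝ) : 0 ≤ ℓ x := by
  rcases h with ⟨m, rfl⟩ | ⟨m, rfl⟩ | ⟨m₁, m₂, -, rfl⟩ | ⟨m, b, hb, rfl⟩
  · exact le_max_right _ _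
  · exact le_max_right _ _
  · exact le_max_right _ _
  · positivity

lemma lipschitzWith (h : IsCanonicalLoss ℓ) : LipschitzWith 1 ℓ := by
  refine LipschitzWith.of_dist_le_mul fun x y => ?_
  simp only [Real.dist_eq, NNReal.coe_one, one_mul]
  rcases h with ⟨m, rfl⟩ | ⟨m, rfl⟩ | ⟨m₁, m₂, -, rfl⟩ | ⟨m, b, hb, rfl⟩ <;> grind

/-- Where the loss is positive it grows at unit rate in some direction. -/
lemma exists_ascent_direction (h : IsCanonicalLoss ℓ) :
    ∃ σ : ℝ → ℝ, Measurable σ ∧ (∀ x, |σ x| = 1) ∧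
      ∀ x s, 0 ≤ s → 0 < ℓ x → ℓ x + s ≤ ℓ (x + σ x * s) := by
  have hmeas (m : ℝ) : Measurable fun x : ℝ => if m ≤ x then (1 : ℝ) else -1 :=
    Measurable.ite measurableSet_Ici measurable_const measurable_const
  rcases h with ⟨m, rfl⟩ | ⟨m, rfl⟩ | ⟨m₁, m₂, hm, rfl⟩ | ⟨m, b, hb, rfl⟩
  · exact ⟨fun _ => 1, measurable_const, by simp, by grind⟩
  · exact ⟨fun _ => -1, measurable_const, by simp, by grind⟩
  · refine ⟨fun x => if m₁ ≤ x then 1 else -1, hmeas m₁, by grind, fun x s hs hx => ?_⟩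
    by_cases hxm : m₁ ≤ x
    · simp only [if_pos hxm, one_mul] at hx ⊢
      grind
    · simp only [if_neg hxm, neg_one_mul] at hx ⊢
      grind
  · refine ⟨fun x => if m ≤ x then 1 else -1, hmeas m, by grind, fun x s hs hx => ?_⟩
    by_cases hxm : m ≤ x
    · simp only [if_pos hxm, one_mul] at hx ⊢
      grind
    · simp only [if_neg hxm, neg_one_mul] at hx ⊢
      grind

/-- The loss dominates an affine function of slope `±1`. -/
lemma exists_affine_le (h : IsCanonicalLoss ℓ) :
    ∃ τ c : ℝ, (τ = 1 ∨ τ = -1) ∧ ∀ x, τ * x + c ≤ ℓ x := by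
  rcases h with ⟨m, rfl⟩ | ⟨m, rfl⟩ | ⟨m₁, m₂, hm, rfl⟩ | ⟨m, b, hb, rfl⟩
  · exact ⟨1, -m, by simp, by grind⟩
  · exact ⟨-1, m, by simp, by grind⟩
  · exact ⟨1, -m₁ - m₂, by simp, by grind⟩
  · exact ⟨1, -m, by simp, by grind⟩

end IsCanonicalLoss

end Loss

section LowerBound

variable {n : ℕ} {nrm : Vec n → ℝ} {p ε : ℝ} {F₀ : Measure (Vec n)} {ℓ : ℝ → ℝ}

lemma memLp_lipschitz_dotp [IsProbabilityMeasure F₀] (h : IsNorm nrm) (hp : 0 < p)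
    (hℓ : LipschitzWith 1 ℓ) (hmom : HasMomentP nrm (ENNReal.ofReal p) F₀) (β : Vec n) :
    MemLp (fun x => ℓ (dotp β x)) (ENNReal.ofReal p) F₀ := by
  rw [hasMomentP_iff hp h.nonneg h.continuous.measurable] at hmom
  refine ((memLp_const |ℓ 0|).add (hmom.const_smul (dualNorm nrm β))).mono
    (hℓ.continuous.comp (continuous_dotp β)).measurable.aestronglyMeasurable
    (.of_forall fun x => ?_)
  have h1 := hℓ.dist_le_mul (dotp β x) 0
  have h2 := abs_dotp_le h β x
  simp only [Real.dist_eq, NNReal.coe_one, one_mul, sub_zero] at h1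
  simp only [Pi.add_apply, Pi.smul_apply, smul_eq_mul, Real.norm_eq_abs]
  refine le_trans ?_ (le_abs_self _)
  have h3 := abs_sub_abs_le_abs_sub (ℓ (dotp β x)) (ℓ 0)
  linarith

/-- When the nominal loss is positive, moving mass proportionally to the loss attains the bound. -/
lemma exists_mem_wballVec_of_pos [IsProbabilityMeasure F₀] (h : IsNorm nrm) (hp : 1 ≤ p)
    (hε : 0 ≤ ε) (hℓ : IsCanonicalLoss ℓ) (hmom : HasMomentP nrm (ENNReal.ofReal p) F₀)
    (β : Vec n) {a : ℝ} (ha : 0 < a)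
    (hL : eLpNorm (fun x => ℓ (dotp β x)) (ENNReal.ofReal p) F₀ = ENNReal.ofReal a) :
    ∃ F ∈ WballVec nrm (ENNReal.ofReal p) F₀ ε,
      ENNReal.ofReal (a + ε * dualNorm nrm β) ≤
        eLpNorm (fun x => ℓ (dotp β x)) (ENNReal.ofReal p) F := by
  obtain ⟨v, hv, hvβ, -⟩ := exists_dotp_eq_dualNorm h β
  obtain ⟨σ, hσm, hσ, hgrow⟩ := hℓ.exists_ascent_direction
  have hB := dualNorm_nonneg h β
  have hβ := (continuous_dotp β).measurable
  have hLm : Measurable fun x => ℓ (dotp β x) := hℓ.lipschitzWith.continuous.measurable.comp hβ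
  have hX : Measurable fun z : Vec n => z + (σ (dotp β z) * (ε / a * ℓ (dotp β z))) • v := by
    have h1 : Measurable fun z : Vec n => σ (dotp β z) * (ε / a * ℓ (dotp β z)) :=
      (hσm.comp hβ).mul (hLm.const_mul _)
    exact measurable_id.add (h1.smul_const v)
  refine ⟨F₀.map fun z => z + (σ (dotp β z) * (ε / a * ℓ (dotp β z))) • v,
    map_mem_wballVec h hp hX measurable_id Measure.map_id hmom ?_, ?_⟩
  · refine (eLpNorm_mono_real (g := (ε / a) • fun z => ℓ (dotp β z)) fun z => ?_).trans_eq ?_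
    · have h1 : 0 ≤ ε / a * ℓ (dotp β z) := mul_nonneg (by positivity) (hℓ.nonneg _)
      simp only [id, add_sub_cancel_left, Pi.smul_apply, smul_eq_mul, Real.norm_eq_abs]
      rw [abs_of_nonneg (h.nonneg _), h.2.1, abs_mul, hσ, one_mul, abs_of_nonneg h1]
      exact mul_le_of_le_one_right h1 hv
    · rw [eLpNorm_const_smul, hL, Real.enorm_of_nonneg (by positivity),
        ← ENNReal.ofReal_mul (by positivity), div_mul_cancel₀ _ ha.ne']
  · rw [eLpNorm_map_measure hLm.aestronglyMeasurable hX.aemeasurable]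
    have h1 : ENNReal.ofReal (a + ε * dualNorm nrm β) =
        eLpNorm ((1 + ε / a * dualNorm nrm β) • fun z => ℓ (dotp β z)) (ENNReal.ofReal p) F₀ := by
      rw [eLpNorm_const_smul, hL, Real.enorm_of_nonneg (by positivity),
        ← ENNReal.ofReal_mul (by positivity)]
      congr 1
      field_simp
    rw [h1]
    refine eLpNorm_mono fun z => ?_
    simp only [Function.comp, Pi.smul_apply, smul_eq_mul, Real.norm_eq_abs]
    rw [abs_of_nonneg (mul_nonneg (by positivity) (hℓ.nonneg _)), abs_of_nonneg (hℓ.nonneg _),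
      dotp_add, dotp_smul, hvβ]
    rcases (hℓ.nonneg (dotp β z)).eq_or_lt with h0 | hpos
    · rw [← h0, mul_zero]
      exact hℓ.nonneg _
    · have h2 := hgrow (dotp β z) (ε / a * ℓ (dotp β z) * dualNorm nrm β) (by positivity) hpos
      rw [← mul_assoc] at h2
      calc _ = ℓ (dotp β z) + ε / a * ℓ (dotp β z) * dualNorm nrm β := by ring
        _ ≤ _ := h2
        _ = _ := by ring_nf

/-- The product of `F₀` with a Bernoulli law giving mass `δ` to `true`. -/
def bernoulliProd {E : Type*} [MeasurableSpace E] (F₀ : Measure E) (δ : ℝ) :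
    Measure (E × Bool) :=
  ENNReal.ofReal (1 - δ) • F₀.map (fun z => (z, false)) +
    ENNReal.ofReal δ • F₀.map (fun z => (z, true))

section bernoulliProd

variable {E : Type*} [MeasurableSpace E] {F : Measure E} {δ : ℝ}

lemma measurable_ite_snd {γ : Type*} [MeasurableSpace γ] {f g : E → γ} (hf : Measurable f)
    (hg : Measurable g) : Measurable fun ω : E × Bool => if ω.2 then f ω.1 else g ω.1 :=
  Measurable.ite (measurable_snd (measurableSet_singleton true))
    (hf.comp measurable_fst) (hg.comp measurable_fst)

lemma map_fst_bernoulliProd (h0 : 0 ≤ δ) (h1 : δ ≤ 1) :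
    (bernoulliProd F δ).map Prod.fst = F := by
  rw [bernoulliProd, Measure.map_add _ _ measurable_fst, Measure.map_smul, Measure.map_smul,
    Measure.map_map measurable_fst measurable_prodMk_right,
    Measure.map_map measurable_fst measurable_prodMk_right]
  simp only [Function.comp_def]
  rw [← Function.id_def, Measure.map_id, ← add_smul, ← ENNReal.ofReal_add (by linarith) h0]
  simp

lemma isProbabilityMeasure_bernoulliProd [IsProbabilityMeasure F] (h0 : 0 ≤ δ) (h1 : δ ≤ 1) :
    IsProbabilityMeasure (bernoulliProd F δ) := by
  have h : IsProbabilityMeasure ((bernoulliProd F δ).map Prod.fst) := by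
    rwa [map_fst_bernoulliProd h0 h1]
  exact (Measure.isProbabilityMeasure_map_iff measurable_fst.aemeasurable).1 h

lemma eLpNorm_ite_bernoulliProd {r : ℝ} (hp : 0 < p) (hr : 0 ≤ r) {g : E → ℝ}
    (hg : Measurable g) :
    eLpNorm (fun ω : E × Bool => if ω.2 then g ω.1 else 0) (ENNReal.ofReal p)
      (bernoulliProd F (r ^ p)) = ENNReal.ofReal r * eLpNorm g (ENNReal.ofReal p) F := by
  have hp0 : ENNReal.ofReal p ≠ 0 := by simpa using hp
  have hm : Measurable fun ω : E × Bool => ‖if ω.2 then g ω.1 else 0‖ₑ ^ p :=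
    (measurable_ite_snd hg measurable_const).enorm.pow_const p
  rw [eLpNorm_eq_lintegral_rpow_enorm_toReal hp0 ENNReal.ofReal_ne_top,
    eLpNorm_eq_lintegral_rpow_enorm_toReal hp0 ENNReal.ofReal_ne_top,
    ENNReal.toReal_ofReal hp.le, bernoulliProd, lintegral_add_measure, lintegral_smul_measure,
    lintegral_smul_measure, lintegral_map hm measurable_prodMk_right,
    lintegral_map hm measurable_prodMk_right]
  simp only [Bool.false_eq_true, if_false, if_true, enorm_zero, ENNReal.zero_rpow_of_pos hp,
    lintegral_zero, smul_eq_mul, mul_zero, zero_add]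
  rw [ENNReal.mul_rpow_of_nonneg _ _ (one_div_nonneg.2 hp.le),
    ← ENNReal.ofReal_rpow_of_nonneg hr hp.le, ← ENNReal.rpow_mul, mul_one_div_cancel hp.ne',
    ENNReal.rpow_one]

end bernoulliProd

/-- Moving a fraction `r ^ p` of the mass by `ε / r` attains `ε‖β‖_*` up to `O(r)`. -/
lemma exists_mem_wballVec_of_small [IsProbabilityMeasure F₀] (h : IsNorm nrm) (hp : 1 ≤ p)
    (hε : 0 ≤ ε) (hℓ : IsCanonicalLoss ℓ) (hmom : HasMomentP nrm (ENNReal.ofReal p) F₀)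
    (β : Vec n) {τ c : ℝ} (hτ : τ = 1 ∨ τ = -1) (hτc : ∀ x, τ * x + c ≤ ℓ x)
    {r : ℝ} (hr : 0 < r) (hr1 : r ≤ 1) :
    ∃ F ∈ WballVec nrm (ENNReal.ofReal p) F₀ ε,
      ENNReal.ofReal (ε * dualNorm nrm β) ≤
        eLpNorm (fun x => ℓ (dotp β x)) (ENNReal.ofReal p) F +
          ENNReal.ofReal r * eLpNorm (fun x => τ * dotp β x + c) (ENNReal.ofReal p) F₀ := by
  have hp0 : 0 < p := one_pos.trans_le hp
  obtain ⟨v, hv, hvβ, -⟩ := exists_dotp_eq_dualNorm h β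
  have hB := dualNorm_nonneg h β
  have hβ := (continuous_dotp β).measurable
  have hLm : Measurable fun x => ℓ (dotp β x) := hℓ.lipschitzWith.continuous.measurable.comp hβ
  have hδ0 : 0 ≤ r ^ p := Real.rpow_nonneg hr.le p
  have hδ1 : r ^ p ≤ 1 := Real.rpow_le_one hr.le hr1 hp0.le
  have hP : IsProbabilityMeasure (bernoulliProd F₀ (r ^ p)) :=
    isProbabilityMeasure_bernoulliProd hδ0 hδ1
  have hτ1 : |τ| = 1 := by rcases hτ with rfl | rfl <;> simp
  have hττ : τ * τ = 1 := by rcases hτ with rfl | rfl <;> simp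
  have hX : Measurable fun ω : Vec n × Bool => if ω.2 then ω.1 + (τ * (ε / r)) • v else ω.1 :=
    measurable_ite_snd (f := fun z => z + (τ * (ε / r)) • v)
      (measurable_id.add_const _) measurable_id
  have hconst (t : ℝ) (ht : 0 ≤ t) :
      eLpNorm (fun ω : Vec n × Bool => if ω.2 then ε / r * t else 0) (ENNReal.ofReal p)
        (bernoulliProd F₀ (r ^ p)) = ENNReal.ofReal (ε * t) := by
    rw [eLpNorm_ite_bernoulliProd hp0 hr.le (g := fun _ => ε / r * t) measurable_const,
      eLpNorm_const _ (by simpa using hp0) (IsProbabilityMeasure.ne_zero F₀)]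
    simp only [measure_univ, ENNReal.one_rpow, mul_one]
    rw [Real.enorm_of_nonneg (by positivity), ← ENNReal.ofReal_mul hr.le]
    congr 1
    field_simp
  refine ⟨_, map_mem_wballVec h hp hX measurable_fst (map_fst_bernoulliProd hδ0 hδ1) hmom ?_, ?_⟩
  · refine (eLpNorm_mono_real fun ω => ?_).trans_eq ((hconst 1 one_pos.le).trans (by rw [mul_one]))
    rcases ω with ⟨z, _ | _⟩
    · simp [h.map_zero]
    · simp only [if_true, add_sub_cancel_left, Real.norm_eq_abs, mul_one]
      have h1 : 0 ≤ ε / r := by positivity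
      rw [abs_of_nonneg (h.nonneg _), h.2.1, abs_mul, hτ1, one_mul, abs_of_nonneg h1]
      exact mul_le_of_le_one_right h1 hv
  · have hA : Measurable fun x => τ * dotp β x + c := (hβ.const_mul τ).add_const c
    rw [← hconst _ hB, ← eLpNorm_ite_bernoulliProd hp0 hr.le hA,
      eLpNorm_map_measure hLm.aestronglyMeasurable hX.aemeasurable,
      ← eLpNorm_norm (fun ω : Vec n × Bool => if ω.2 then τ * dotp β ω.1 + c else 0)]
    refine (eLpNorm_mono_real fun ω => ?_).trans (eLpNorm_add_le
      (hLm.comp hX).aestronglyMeasurable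
      (measurable_ite_snd hA measurable_const).norm.aestronglyMeasurable (by simpa using hp))
    rcases ω with ⟨z, _ | _⟩
    · simpa using hℓ.nonneg _
    · simp only [if_true, Real.norm_eq_abs, Pi.add_apply, Function.comp]
      have h1 := hτc (dotp β (z + (τ * (ε / r)) • v))
      have h2 : 0 ≤ ε / r * dualNorm nrm β := by positivity
      rw [dotp_add, dotp_smul, hvβ] at h1 ⊢
      have h3 : τ * (τ * (ε / r) * dualNorm nrm β) = ε / r * dualNorm nrm β := by
        rw [← mul_assoc, ← mul_assoc, hττ, one_mul]
      rw [mul_add, h3] at h1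
      rw [abs_of_nonneg h2]
      linarith [neg_abs_le (τ * dotp β z + c)]

end LowerBound

lemma sSup_wballVec_eq {n : ℕ} {nrm : Vec n → ℝ} (h : IsNorm nrm) {ℓ : ℝ → ℝ}
    (hℓ : IsCanonicalLoss ℓ) {p : ℝ} (hp : 1 ≤ p) {F₀ : Measure (Vec n)}
    [IsProbabilityMeasure F₀] (hmom : HasMomentP nrm (ENNReal.ofReal p) F₀)
    {ε : ℝ} (hε : 0 ≤ ε) (β : Vec n) :
    sSup {s | ∃ F ∈ WballVec nrm (ENNReal.ofReal p) F₀ ε, s = ∫ x, ℓ (dotp β x) ^ p ∂F} =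
      ((∫ x, ℓ (dotp β x) ^ p ∂F₀) ^ (1 / p) + ε * dualNorm nrm β) ^ p := by
  have hp0 : 0 < p := one_pos.trans_le hp
  have hB := dualNorm_nonneg h β
  have hL0 (x : Vec n) : 0 ≤ ℓ (dotp β x) := hℓ.nonneg _
  have hLm : Measurable fun x => ℓ (dotp β x) :=
    (hℓ.lipschitzWith.continuous.comp (continuous_dotp β)).measurable
  have hfin := (memLp_lipschitz_dotp h hp0 hℓ.lipschitzWith hmom β).eLpNorm_ne_top
  simp_rw [integral_rpow_eq_eLpNorm hp0 hL0 hLm]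
  set N : Measure (Vec n) → ℝ≥0∞ := fun F =>
    eLpNorm (fun x => ℓ (dotp β x)) (ENNReal.ofReal p) F
  change N F₀ ≠ ∞ at hfin
  change sSup {s | ∃ F ∈ _, s = (N F).toReal ^ p} = (((N F₀).toReal ^ p) ^ (1 / p) + _) ^ p
  obtain ⟨a, ha0, ha⟩ : ∃ a : ℝ, 0 ≤ a ∧ N F₀ = ENNReal.ofReal a :=
    ⟨_, ENNReal.toReal_nonneg, (ENNReal.ofReal_toReal hfin).symm⟩
  rw [ha, ENNReal.toReal_ofReal ha0, ← Real.rpow_mul ha0, mul_one_div_cancel hp0.ne',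
    Real.rpow_one]
  have hR : 0 ≤ a + ε * dualNorm nrm β := by positivity
  have hle : ∀ F ∈ WballVec nrm (ENNReal.ofReal p) F₀ ε,
      N F ≤ ENNReal.ofReal (a + ε * dualNorm nrm β) := by
    intro F hF
    rw [ENNReal.ofReal_add ha0 (by positivity), ← ha]
    exact eLpNorm_loss_le h hp hε hℓ.nonneg hℓ.lipschitzWith β hF
  have hub : ∀ s ∈ {s | ∃ F ∈ WballVec nrm (ENNReal.ofReal p) F₀ ε, s = (N F).toReal ^ p},
      s ≤ (a + ε * dualNorm nrm β) ^ p := by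
    rintro _ ⟨F, hF, rfl⟩
    exact Real.rpow_le_rpow ENNReal.toReal_nonneg
      (ENNReal.toReal_le_of_le_ofReal hR (hle F hF)) hp0.le
  refine le_antisymm (Real.sSup_le hub (Real.rpow_nonneg hR p)) ?_
  set S := sSup {s | ∃ F ∈ WballVec nrm (ENNReal.ofReal p) F₀ ε, s = (N F).toReal ^ p}
  have hmem : ∀ F ∈ WballVec nrm (ENNReal.ofReal p) F₀ ε, (N F).toReal ^ p ≤ S :=
    fun F hF => le_csSup ⟨_, hub⟩ ⟨F, hF, rfl⟩
  rcases ha0.eq_or_lt with rfl | hapos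
  · obtain ⟨τ, c, hτ, hτc⟩ := hℓ.exists_affine_le
    have hS0 : 0 ≤ S := Real.sSup_nonneg (by
      rintro _ ⟨F, -, rfl⟩
      positivity)
    have hlip : LipschitzWith 1 fun x : ℝ => τ * x + c := by
      refine LipschitzWith.of_dist_le_mul fun x y => ?_
      simp only [Real.dist_eq, NNReal.coe_one, one_mul]
      rcases hτ with rfl | rfl <;> grind
    obtain ⟨K, hK0, hK⟩ : ∃ K : ℝ, 0 ≤ K ∧
        eLpNorm (fun x => τ * dotp β x + c) (ENNReal.ofReal p) F₀ = ENNReal.ofReal K :=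
      ⟨_, ENNReal.toReal_nonneg, (ENNReal.ofReal_toReal
        (memLp_lipschitz_dotp h hp0 hlip hmom β).eLpNorm_ne_top).symm⟩
    have key : ∀ r ∈ Ioc (0 : ℝ) 1, ε * dualNorm nrm β ≤ S ^ p⁻¹ + r * K := by
      rintro r ⟨hr, hr1⟩
      obtain ⟨F, hF, hFle⟩ := exists_mem_wballVec_of_small h hp hε hℓ hmom β hτ hτc hr hr1
      change _ ≤ N F + _ at hFle
      have hNF : N F ≠ ∞ := ((hle F hF).trans_lt ENNReal.ofReal_lt_top).ne
      rw [hK, ← ENNReal.ofReal_mul hr.le, ← ENNReal.ofReal_toReal hNF,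
        ← ENNReal.ofReal_add ENNReal.toReal_nonneg (by positivity),
        ENNReal.ofReal_le_ofReal_iff (by positivity)] at hFle
      have h1 : (N F).toReal ≤ S ^ p⁻¹ :=
        (Real.le_rpow_inv_iff_of_pos ENNReal.toReal_nonneg hS0 hp0).2 (hmem F hF)
      linarith
    have hlim : Filter.Tendsto (fun r : ℝ => S ^ p⁻¹ + r * K) (nhdsWithin 0 (Ioi 0))
        (nhds (S ^ p⁻¹)) := by
      have hc : Continuous fun r : ℝ => S ^ p⁻¹ + r * K := by fun_prop
      have := hc.tendsto 0
      rw [zero_mul, add_zero] at this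
      exact this.mono_left nhdsWithin_le_nhds
    have h1 : ε * dualNorm nrm β ≤ S ^ p⁻¹ :=
      ge_of_tendsto hlim (Filter.eventually_of_mem (Ioc_mem_nhdsGT one_pos) key)
    rw [zero_add]
    exact (Real.le_rpow_inv_iff_of_pos (by positivity) hS0 hp0).1 h1
  · obtain ⟨F, hF, hFle⟩ := exists_mem_wballVec_of_pos h hp hε hℓ hmom β hapos ha
    refine le_trans (Real.rpow_le_rpow hR ?_ hp0.le) (hmem F hF)
    exact (ENNReal.ofReal_le_iff_le_toReal ((hle F hF).trans_lt ENNReal.ofReal_lt_top).ne).1 hFle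

/-- Theorem 6 of the paper: for the four canonical losses, the Wasserstein
DRO model with loss `ℓ^p` is exactly equivalent to the `(‖·‖_p + ε‖β‖_*)^p` regularization
problem. -/
theorem stmt9 {n : ℕ} (nrm : Vec n → ℝ) (hnrm : IsNorm nrm)
    (ℓ : ℝ → ℝ) (hℓ : IsCanonicalLoss ℓ)
    (p : ℝ) (hp : 1 < p)
    (F₀ : Measure (Vec n)) (hF₀ : IsProbabilityMeasure F₀)
    (hmom : HasMomentP nrm (ENNReal.ofReal p) F₀)
    (ε : ℝ) (hε : 0 ≤ ε) (D : Set (Vec n)) :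
    sInf {r | ∃ β ∈ D, r =
        sSup {s | ∃ F ∈ WballVec nrm (ENNReal.ofReal p) F₀ ε,
          s = ∫ x, ℓ (dotp β x) ^ p ∂F}}
      = sInf {r | ∃ β ∈ D, r =
          ((∫ x, ℓ (dotp β x) ^ p ∂F₀) ^ (1 / p) + ε * dualNorm nrm β) ^ p} := by
  simp_rw [sSup_wballVec_eq hnrm hℓ hp.le hmom hε]
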